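/- There is an explicit bijection Λ_3(f+u, f, v) → Λ(u, v) × Λ_4(f) × Θ_2(f+v, f); moreover Λ_4(f) consists of exactly one walk, namely (1,2,1,2,…,2,1) of length 2f, whose θ_i-weight contribution from its single edge is p·X_{2f}. -/

import Mathlib

open scoped Classical

/-- `w` is a closed walk of `k` steps over `ℕ`: a list `(w_1, …, w_{k+1})` with `w_{k+1} = w_1`,
each step joining two distinct vertices. -/
def IsClosedWalk (k : ℕ) (w : List ℕ) : Prop :=
  w.length = k + 1 ∧ w.getD k 0 = w.getD 0 0 ∧ ∀ i < k, w.getD i 0 ≠ w.getD (i + 1) 0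

/-- The vertex set `V_w` of the walk. -/
def vertexSet (w : List ℕ) : Finset ℕ := w.toFinset

/-- The edge set `E_w = ∪_i {(w_i, w_{i+1})}` (unordered pairs) of the skeleton of `w`. -/
def edgeSet (k : ℕ) (w : List ℕ) : Finset (Sym2 ℕ) :=
  (Finset.range k).image fun i => s(w.getD i 0, w.getD (i + 1) 0)

/-- `n_w(e)`: the number of traversals of the edge `e` by `w`, in either direction. -/
def traversals (k : ℕ) (w : List ℕ) (e : Sym2 ℕ) : ℕ :=
  ((Finset.range k).filter fun i => s(w.getD i 0, w.getD (i + 1) 0) = e).card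

/-- `w` is minimal: `w_1 = 1` and each newly visited vertex gets the number equal to one plus
the number of previously visited vertices. -/
def IsMinimal (k : ℕ) (w : List ℕ) : Prop :=
  w.getD 0 0 = 1 ∧ ∀ i < k,
    w.getD (i + 1) 0 ∈ (w.take (i + 1)).toFinset ∨
      w.getD (i + 1) 0 = (w.take (i + 1)).toFinset.card + 1

/-- The skeleton graph `G_w` of the walk `w`. -/
def skeleton (k : ℕ) (w : List ℕ) : SimpleGraph ℕ :=
  SimpleGraph.fromEdgeSet ↑(edgeSet k w)

/-- `w` is an essential walk: a minimal closed walk whose skeleton is a tree. -/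
def IsEssential (k : ℕ) (w : List ℕ) : Prop :=
  IsClosedWalk k w ∧ IsMinimal k w ∧
    ((skeleton k w).induce (↑(vertexSet w) : Set ℕ)).IsTree

/-- `β(w)`: the number of vertices of `V_w` at even distance from the root `ρ = w_1`
in the tree `G_w`. -/
noncomputable def beta (k : ℕ) (w : List ℕ) : ℕ :=
  Set.ncard {v | v ∈ vertexSet w ∧ Even ((skeleton k w).dist (w.getD 0 0) v)}

/-- The weight `θ_1(w) = α^{β(w)} (1-α)^{|V_w|-β(w)} ∏_{e∈E_w} p X_{n_w(e)}`. -/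
noncomputable def theta1 (p α : ℝ) (X : ℕ → ℝ) (k : ℕ) (w : List ℕ) : ℝ :=
  α ^ beta k w * (1 - α) ^ ((vertexSet w).card - beta k w) *
    ∏ e ∈ edgeSet k w, p * X (traversals k w e)

/-- The weight `θ_2(w) = (1-α)^{β(w)} α^{|V_w|-β(w)} ∏_{e∈E_w} p X_{n_w(e)}`. -/
noncomputable def theta2 (p α : ℝ) (X : ℕ → ℝ) (k : ℕ) (w : List ℕ) : ℝ :=
  (1 - α) ^ beta k w * α ^ ((vertexSet w).card - beta k w) *
    ∏ e ∈ edgeSet k w, p * X (traversals k w e)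

/-- The number `r` of steps of `w` starting from the root `ρ = w_1`. -/
def rootSteps (k : ℕ) (w : List ℕ) : ℕ :=
  ((Finset.range k).filter fun i => w.getD i 0 = w.getD 0 0).card

/-- `Λ(l,r)`: the set of essential walks of length `2l` with `r` steps starting from the root. -/
def Lambda (l r : ℕ) : Set (List ℕ) :=
  {w | IsEssential (2 * l) w ∧ rootSteps (2 * l) w = r}

/-- `S⁽¹⁾(l,r)`: the sum of the weights `θ_1` of the walks of `Λ(l,r)`. -/
noncomputable def S1 (p α : ℝ) (X : ℕ → ℝ) (l r : ℕ) : ℝ :=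
  ∑ᶠ w ∈ Lambda l r, theta1 p α X (2 * l) w

/-- `S⁽²⁾(l,r)`: the sum of the weights `θ_2` of the walks of `Λ(l,r)`. -/
noncomputable def S2 (p α : ℝ) (X : ℕ → ℝ) (l r : ℕ) : ℝ :=
  ∑ᶠ w ∈ Lambda l r, theta2 p α X (2 * l) w

/-- The skeleton of `w` with the first edge `(ρ,ν) = (w_1,w_2)` removed. -/
def prunedSkeleton (k : ℕ) (w : List ℕ) : SimpleGraph ℕ :=
  SimpleGraph.fromEdgeSet (↑(edgeSet k w) \ {s(w.getD 0 0, w.getD 1 0)})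

/-- Twice the half-length `u` of the walk restricted to the component `G_2` of `ν` obtained by
deleting the edge `(ρ,ν)` from `G_w`: the number of steps of `w` along edges of `G_2`. -/
noncomputable def nuSteps (k : ℕ) (w : List ℕ) : ℕ :=
  ((Finset.range k).filter fun i =>
    s(w.getD i 0, w.getD (i + 1) 0) ≠ s(w.getD 0 0, w.getD 1 0) ∧
      (prunedSkeleton k w).Reachable (w.getD 1 0) (w.getD i 0)).card

/-- `Λ_1(l,r,u,f)`: the walks of `Λ(l,r)` traversing the first edge `(ρ,ν)` exactly `f` times
and whose restriction to the component of `ν` has half-length `u`. -/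
def Lambda1 (l r u f : ℕ) : Set (List ℕ) :=
  {w | w ∈ Lambda l r ∧ traversals (2 * l) w s(w.getD 0 0, w.getD 1 0) = f ∧
    nuSteps (2 * l) w = 2 * u}

/-- `Λ_2(l,r)`: the walks of `Λ(l,r)` whose skeleton has exactly one edge attached
to the root. -/
def Lambda2 (l r : ℕ) : Set (List ℕ) :=
  {w | w ∈ Lambda l r ∧ ((edgeSet (2 * l) w).filter fun e => w.getD 0 0 ∈ e).card = 1}

/-- `S⁽¹⁾_1(l,r,u,f)`: the sum of the weights `θ_1` of the walks of `Λ_1(l,r,u,f)`. -/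
noncomputable def S1₁ (p α : ℝ) (X : ℕ → ℝ) (l r u f : ℕ) : ℝ :=
  ∑ᶠ w ∈ Lambda1 l r u f, theta1 p α X (2 * l) w

/-- `S⁽²⁾_1(l,r,u,f)`: the sum of the weights `θ_2` of the walks of `Λ_1(l,r,u,f)`. -/
noncomputable def S2₁ (p α : ℝ) (X : ℕ → ℝ) (l r u f : ℕ) : ℝ :=
  ∑ᶠ w ∈ Lambda1 l r u f, theta2 p α X (2 * l) w

/-- `S⁽¹⁾_2(l,r)`: the sum of the weights `θ_1` of the walks of `Λ_2(l,r)`. -/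
noncomputable def S1₂ (p α : ℝ) (X : ℕ → ℝ) (l r : ℕ) : ℝ :=
  ∑ᶠ w ∈ Lambda2 l r, theta1 p α X (2 * l) w

/-- `S⁽²⁾_2(l,r)`: the sum of the weights `θ_2` of the walks of `Λ_2(l,r)`. -/
noncomputable def S2₂ (p α : ℝ) (X : ℕ → ℝ) (l r : ℕ) : ℝ :=
  ∑ᶠ w ∈ Lambda2 l r, theta2 p α X (2 * l) w

/-- `v`: the number of steps of `w` starting from `ν = w_2` other than the steps `ν → ρ`. -/
def nuOutSteps (k : ℕ) (w : List ℕ) : ℕ :=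
  ((Finset.range k).filter fun i =>
    w.getD i 0 = w.getD 1 0 ∧ w.getD (i + 1) 0 ≠ w.getD 0 0).card

/-- `Λ_3(l,f,v)`: the walks of `Λ_2(l,f)` with exactly `v` steps starting from `ν`
other than `ν → ρ`. -/
def Lambda3 (l f v : ℕ) : Set (List ℕ) :=
  {w | w ∈ Lambda2 l f ∧ nuOutSteps (2 * l) w = v}

/-- `Λ_4(f)`: the essential walks of length `2f` whose skeleton is the single
edge `(ρ,ν) = (1,2)`. -/
def Lambda4 (f : ℕ) : Set (List ℕ) :=
  {w | IsEssential (2 * f) w ∧ edgeSet (2 * f) w = {s(1, 2)}}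

/-- `Θ_2(m,f)`: the set of 0–1 sequences of length `m` with exactly `f` ones whose last
entry is `1`. -/
def Theta2Seq (m f : ℕ) : Set (List Bool) :=
  {t | t.length = m ∧ t.count true = f ∧ t.getLast? = some true}

/-- The alternating walk `(1,2,1,2,…,2,1)` of length `2f`. -/
def altWalk : ℕ → List ℕ
  | 0 => [1]
  | f + 1 => 1 :: 2 :: altWalk f

/-- The list of steps `(w_i, w_{i+1})` of a walk. -/
def walkSteps (w : List ℕ) : List (ℕ × ℕ) := w.zip w.tail

/-- The edges traversed by a walk. -/
def walkEdges (w : List ℕ) : Finset (Sym2 ℕ) := ((walkSteps w).map fun p => s(p.1, p.2)).toFinset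

/-- Each entry of the list either lies in the set of vertices visited so far (initially `S`)
or is one plus the number of these vertices. -/
def MinimalFrom : Finset ℕ → List ℕ → Prop
  | _, [] => True
  | S, x :: l => (x ∈ S ∨ x = S.card + 1) ∧ MinimalFrom (insert x S) l

@[simp]
theorem walkSteps_singleton (a : ℕ) : walkSteps [a] = [] := rfl

@[simp]
theorem walkSteps_cons_cons (a b : ℕ) (l : List ℕ) :
    walkSteps (a :: b :: l) = (a, b) :: walkSteps (b :: l) := rfl

@[simp]
theorem walkEdges_singleton (a : ℕ) : walkEdges [a] = ∅ := rfl

@[simp]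
theorem walkEdges_cons_cons (a b : ℕ) (l : List ℕ) :
    walkEdges (a :: b :: l) = insert s(a, b) (walkEdges (b :: l)) := by
  simp [walkEdges]

theorem mem_walkEdges {w : List ℕ} {e : Sym2 ℕ} :
    e ∈ walkEdges w ↔ ∃ p ∈ walkSteps w, s(p.1, p.2) = e := by
  simp [walkEdges]

theorem walkSteps_append_singleton (l : List ℕ) (a b : ℕ) :
    walkSteps (l ++ [a, b]) = walkSteps (l ++ [a]) ++ [(a, b)] := by
  induction l with
  | nil => rfl
  | cons x l ih => cases l <;> simp_all

theorem mem_of_mem_walkEdges {w : List ℕ} {e : Sym2 ℕ} (he : e ∈ walkEdges w) {x : ℕ}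
    (hx : x ∈ e) : x ∈ w := by
  obtain ⟨⟨a, b⟩, hp, rfl⟩ := mem_walkEdges.1 he
  have hp := List.of_mem_zip hp
  rcases Sym2.mem_iff.1 hx with rfl | rfl
  · exact hp.1
  · exact List.mem_of_mem_tail hp.2

theorem map_range_eq_walkSteps {k : ℕ} {w : List ℕ} (h : w.length = k + 1) :
    (List.range k).map (fun i => (w.getD i 0, w.getD (i + 1) 0)) = walkSteps w := by
  apply List.ext_getElem
  · simp [walkSteps, h]
  · intro i h₁ h₂
    simp only [List.length_map, List.length_range] at h₁
    simp [walkSteps, List.getD_eq_getElem?_getD,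
      show i < w.length by omega, show i + 1 < w.length by omega]

theorem card_filter_range_eq_countP {k : ℕ} {w : List ℕ} (h : w.length = k + 1)
    (P : ℕ × ℕ → Prop) [DecidablePred P]
    [DecidablePred fun i => P (w.getD i 0, w.getD (i + 1) 0)] :
    ((Finset.range k).filter fun i => P (w.getD i 0, w.getD (i + 1) 0)).card =
      (walkSteps w).countP P := by
  rw [← map_range_eq_walkSteps h, List.countP_map, List.countP_eq_length_filter, Finset.card_def,
    Finset.filter_val, Finset.range_val, Multiset.range, Multiset.filter_coe, Multiset.coe_card]
  congr!
  simp

theorem edgeSet_eq_walkEdges {k : ℕ} {w : List ℕ} (h : w.length = k + 1) :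
    edgeSet k w = walkEdges w := by
  ext e
  simp [edgeSet, walkEdges, ← map_range_eq_walkSteps h]

theorem countP_walkSteps_fst (c : ℕ) (w : List ℕ) :
    (walkSteps w).countP (fun p => p.1 = c) = w.dropLast.count c := by
  induction w with
  | nil => rfl
  | cons a l ih =>
    cases l with
    | nil => rfl
    | cons b l => simp [List.countP_cons, List.count_cons, ih]

theorem minimalFrom_iff (S : Finset ℕ) (l : List ℕ) :
    MinimalFrom S l ↔ ∀ i < l.length,
      l.getD i 0 ∈ S ∪ (l.take i).toFinset ∨
        l.getD i 0 = (S ∪ (l.take i).toFinset).card + 1 := by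
  induction l generalizing S with
  | nil => simp [MinimalFrom]
  | cons x l ih =>
    rw [MinimalFrom, ih]
    constructor
    · rintro ⟨h₀, h⟩ (_ | i) hi
      · simpa using h₀
      · simpa using h i (by simpa using hi)
    · intro h
      refine ⟨by simpa using h 0 (by simp), fun i hi => ?_⟩
      simpa using h (i + 1) (by simpa using hi)

theorem minimalFrom_append_singleton {S : Finset ℕ} {a : ℕ} (ha : a ∈ S) (l : List ℕ) :
    MinimalFrom S (l ++ [a]) ↔ MinimalFrom S l := by
  induction l generalizing S with
  | nil => simp [MinimalFrom, ha]
  | cons x l ih => simp [MinimalFrom, ih (Finset.mem_insert_of_mem ha)]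

theorem MinimalFrom.pos {S : Finset ℕ} {l : List ℕ} (h : MinimalFrom S l)
    (hS : ∀ x ∈ S, 1 ≤ x) : ∀ x ∈ l, 1 ≤ x := by
  induction l generalizing S with
  | nil => simp
  | cons x l ih =>
    have hx : 1 ≤ x := h.1.elim (hS x) (by omega)
    have := ih h.2 (by simpa [hx] using hS)
    simpa [hx] using this

theorem skeleton_induce_connected {k : ℕ} {w : List ℕ} (h : w.length = k + 1) :
    ((skeleton k w).induce (↑(vertexSet w) : Set ℕ)).Connected := by
  have hmem : ∀ i ≤ k, w.getD i 0 ∈ (↑(vertexSet w) : Set ℕ) := by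
    intro i hi
    have : i < w.length := by omega
    simp [vertexSet, List.getD_eq_getElem?_getD, this]
  have hreach : ∀ i (hi : i ≤ k),
      ((skeleton k w).induce (↑(vertexSet w) : Set ℕ)).Reachable
        ⟨w.getD 0 0, hmem 0 (Nat.zero_le k)⟩ ⟨w.getD i 0, hmem i hi⟩ := by
    intro i
    induction i with
    | zero => intro _; exact .rfl
    | succ i ih =>
      intro hi
      refine (ih (by omega)).trans ?_
      by_cases heq : w.getD i 0 = w.getD (i + 1) 0
      · simp only [heq]; exact .rfl
      · apply SimpleGraph.Adj.reachable
        simp only [SimpleGraph.comap_adj, Function.Embedding.subtype_apply, skeleton,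
          SimpleGraph.fromEdgeSet_adj]
        refine ⟨?_, heq⟩
        simp only [edgeSet, Finset.coe_image, Set.mem_image, Finset.coe_range, Set.mem_Iio]
        exact ⟨i, hi, rfl⟩
  rw [SimpleGraph.connected_iff_exists_forall_reachable]
  refine ⟨⟨w.getD 0 0, hmem 0 (Nat.zero_le k)⟩, ?_⟩
  rintro ⟨x, hx⟩
  obtain ⟨i, hi, rfl⟩ := List.getElem_of_mem (List.mem_toFinset.1 hx)
  have := hreach i (by omega)
  simpa only [List.getD_eq_getElem _ _ hi] using this

theorem skeleton_induce_isTree_iff {k : ℕ} {w : List ℕ} (h : w.length = k + 1)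
    (hd : ∀ e ∈ walkEdges w, ¬ e.IsDiag) :
    ((skeleton k w).induce (↑(vertexSet w) : Set ℕ)).IsTree ↔
      (walkEdges w).card + 1 = w.toFinset.card := by
  rw [SimpleGraph.isTree_iff_connected_and_card, and_iff_right (skeleton_induce_connected h)]
  have hV : Nat.card (↑(↑(vertexSet w) : Set ℕ)) = w.toFinset.card := by
    rw [Nat.card_coe_set_eq, Set.ncard_coe_finset, vertexSet]
  have hE : Nat.card ((skeleton k w).induce (↑(vertexSet w) : Set ℕ)).edgeSet =
      (walkEdges w).card := by
    rw [Nat.card_coe_set_eq, ← Set.ncard_coe_finset,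
      ← Set.ncard_image_of_injective _ (Sym2.map.injective Subtype.val_injective)]
    congr 1
    ext e
    constructor
    · rintro ⟨e', he', rfl⟩
      induction e' with | _ a b
      have := (SimpleGraph.mem_edgeSet _).1 he'
      simp only [SimpleGraph.comap_adj, Function.Embedding.subtype_apply, skeleton,
        SimpleGraph.fromEdgeSet_adj, edgeSet_eq_walkEdges h] at this
      exact this.1
    · intro he
      have he' : e ∈ walkEdges w := he
      induction e with | _ a b
      have ha : a ∈ w := mem_of_mem_walkEdges he' (by simp)
      have hb : b ∈ w := mem_of_mem_walkEdges he' (by simp)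
      refine ⟨s(⟨a, by simpa [vertexSet] using ha⟩, ⟨b, by simpa [vertexSet] using hb⟩), ?_, rfl⟩
      rw [SimpleGraph.mem_edgeSet]
      simp only [SimpleGraph.comap_adj, Function.Embedding.subtype_apply, skeleton,
        SimpleGraph.fromEdgeSet_adj, edgeSet_eq_walkEdges h]
      exact ⟨he, by simpa using hd _ he'⟩
  rw [hV, hE]

theorem isEssential_cons_iff {k : ℕ} {l : List ℕ} :
    IsEssential k (1 :: l) ↔ l.length = k ∧ (1 :: l).getLast? = some 1 ∧
      (∀ e ∈ walkEdges (1 :: l), ¬ e.IsDiag) ∧ MinimalFrom {1} l ∧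
      (walkEdges (1 :: l)).card + 1 = (1 :: l).toFinset.card := by
  have hlen : (1 :: l).length = k + 1 ↔ l.length = k := by simp
  rw [IsEssential, IsClosedWalk, and_assoc, hlen]
  refine and_congr_right fun h => ?_
  have h' := hlen.2 h
  have hlast : (1 :: l).getD k 0 = (1 :: l).getD 0 0 ↔ (1 :: l).getLast? = some 1 := by
    rw [List.getLast?_eq_getElem?, h']
    simp [List.getD_eq_getElem?_getD, h]
  have hdiag : (∀ i < k, (1 :: l).getD i 0 ≠ (1 :: l).getD (i + 1) 0) ↔
      ∀ e ∈ walkEdges (1 :: l), ¬ e.IsDiag := by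
    rw [← edgeSet_eq_walkEdges h']
    simp [edgeSet]
  have hmin : IsMinimal k (1 :: l) ↔ MinimalFrom {1} l := by
    rw [minimalFrom_iff, IsMinimal, h]
    simp
  rw [hlast, hdiag, hmin, and_assoc]
  refine and_congr_right fun _ => and_congr_right fun hd => and_congr_right fun _ => ?_
  exact skeleton_induce_isTree_iff h' hd

theorem IsEssential.exists_eq_cons {k : ℕ} {w : List ℕ} (h : IsEssential k w) :
    ∃ l, w = 1 :: l := by
  cases w with
  | nil => simpa using h.1.1
  | cons a l => exact ⟨l, by simpa using h.2.1.1⟩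

/-- `Spliced b w t`: the walk `b` arises from the walk `w`, which ends at `1`, by adding one to
every vertex and inserting excursions `2 → 1 → 2` as prescribed by `t`: reading the departures
of `b` from the vertex `2` in order, the entry `true` marks the start of an excursion
and the entry `false` a step of `w`. -/
inductive Spliced : List ℕ → List ℕ → List Bool → Prop
  | nil : Spliced [2] [1] []
  | excursion {b w t} : Spliced b (1 :: w) t → Spliced (2 :: 1 :: b) (1 :: w) (true :: t)
  | root {b w t} : Spliced b w t → Spliced (2 :: b) (1 :: w) (false :: t)
  | other {x b w t} : 2 ≤ x → Spliced b w t → Spliced ((x + 1) :: b) (x :: w) t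

namespace Spliced

variable {b b' w w' : List ℕ} {t t' : List Bool}

theorem exists_heads (h : Spliced b w t) :
    ∃ x b₁ w₁, 1 ≤ x ∧ b = (x + 1) :: b₁ ∧ w = x :: w₁ := by
  cases h with
  | nil => exact ⟨1, _, _, le_rfl, rfl, rfl⟩
  | excursion _ => exact ⟨1, _, _, le_rfl, rfl, rfl⟩
  | root _ => exact ⟨1, _, _, le_rfl, rfl, rfl⟩
  | other hx _ => exact ⟨_, _, _, by omega, rfl, rfl⟩

theorem not_nil_left : ¬ Spliced [] w t := by
  intro h
  obtain ⟨x, b₁, w₁, -, h, -⟩ := h.exists_heads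
  simp at h

theorem not_one_cons : ¬ Spliced (1 :: b) w t := by
  intro h
  obtain ⟨x, b₁, w₁, hx, h, -⟩ := h.exists_heads
  simp at h
  omega

theorem pos (h : Spliced b w t) : ∀ x ∈ w, 1 ≤ x := by
  induction h <;> simp_all
  omega

theorem length_eq (h : Spliced b w t) : b.length = w.length + 2 * t.count true := by
  induction h <;> simp_all <;> omega

theorem count_one_left (h : Spliced b w t) : b.count 1 = t.count true := by
  induction h <;> simp_all [List.count_cons]
  omega

theorem count_one_right (h : Spliced b w t) : w.count 1 = t.count false + 1 := by
  induction h <;> simp_all [List.count_cons]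
  omega

theorem getLast?_right (h : Spliced b w t) : w.getLast? = some 1 := by
  induction h <;> simp_all [List.getLast?_cons]

theorem toFinset_left (h : Spliced b w t) :
    b.toFinset = w.toFinset.image (· + 1) ∪ if true ∈ t then {1} else ∅ := by
  induction h with
  | nil => rfl
  | excursion h ih => ext y; simp [ih]; split_ifs <;> grind
  | root h ih => simp [ih]
  | other hx h ih => simp [ih]

theorem walkEdges_left (h : Spliced b w t) :
    walkEdges b =
      (walkEdges w).image (Sym2.map (· + 1)) ∪ if true ∈ t then {s(1, 2)} else ∅ := by
  induction h with
  | nil => rfl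
  | excursion h ih =>
    obtain ⟨x, b₁, w₁, hx, rfl, hw⟩ := h.exists_heads
    obtain rfl : 1 = x := by simpa using congrArg List.head? hw
    ext e
    simp only [Nat.reduceAdd, walkEdges_cons_cons, Finset.mem_insert] at ih ⊢
    rw [ih, Sym2.eq_swap]
    split_ifs <;> simp_all
  | root h ih =>
    obtain ⟨x, b₁, w₁, hx, rfl, rfl⟩ := h.exists_heads
    simp [ih]
  | other hx h ih =>
    obtain ⟨x, b₁, w₁, hx, rfl, rfl⟩ := h.exists_heads
    simp [ih]

theorem countP_walkSteps (h : Spliced b w t) :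
    (walkSteps b).countP (fun p => p.1 = 2 ∧ p.2 ≠ 1) = t.count false := by
  induction h with
  | nil => rfl
  | excursion h ih =>
    obtain ⟨x, b₁, w₁, hx, rfl, hw⟩ := h.exists_heads
    obtain rfl : 1 = x := by simpa using congrArg List.head? hw
    simp_all
  | root h ih =>
    obtain ⟨x, b₁, w₁, hx, rfl, rfl⟩ := h.exists_heads
    simp_all [List.countP_cons]
    omega
  | other hx' h ih =>
    obtain ⟨x, b₁, w₁, hx, rfl, rfl⟩ := h.exists_heads
    simp_all [List.countP_cons]
    omega

theorem minimalFrom_iff (h : Spliced b w t) {S : Finset ℕ} (hS : 1 ∈ S)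
    (hS₀ : 0 ∉ S) :
    MinimalFrom (insert 1 (S.image (· + 1))) b ↔ MinimalFrom S w := by
  induction h generalizing S with
  | nil => simp [MinimalFrom, hS]
  | excursion h ih =>
    refine Iff.trans ?_ (ih hS hS₀)
    simp [MinimalFrom, hS, Finset.insert_comm 2 1]
  | root h ih =>
    refine and_congr ?_ (Iff.trans ?_ (ih (S := insert 1 S) (by simp) (by simpa using hS₀)))
    · simp [hS]
    · simp [hS, Finset.insert_comm 2 1]
  | @other x b w t hx h ih =>
    refine and_congr ?_
      (Iff.trans ?_ (ih (S := insert x S) (by simp [hS]) (by simp [hS₀]; omega)))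
    · rw [Finset.card_insert_of_notMem (by simpa using hS₀),
        Finset.card_image_of_injective _ (add_left_injective 1)]
      simp [show x ≠ 0 by omega]
    · rw [Finset.image_insert, Finset.insert_comm]

theorem getLast?_eq_some_true_iff (h : Spliced b w t) :
    t.getLast? = some true ↔ [1, 2] <:+ b := by
  induction h with
  | nil => simp [List.suffix_cons_iff]
  | @excursion b w t h ih =>
    have ht : b = [2] ↔ t = [] := by
      constructor
      · rintro rfl
        cases h with
        | nil => rfl
        | root h => exact (not_nil_left h).elim
        | other h _ => omega
      · rintro rfl
        have := h.length_eq
        have := h.count_one_right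
        cases h with
        | nil => rfl
        | other h _ => omega
    rw [List.suffix_cons_iff, List.suffix_cons_iff, ← ih]
    have hb : 2 :: 1 :: b ≠ [1, 2] := by simp
    cases t <;> simp_all [List.getLast?_cons, eq_comm (a := [2])]
  | @root b w t h ih =>
    rw [List.suffix_cons_iff, ← ih]
    cases t <;> simp [List.getLast?_cons]
  | @other x b w t hx h ih =>
    rw [List.suffix_cons_iff, ← ih]
    simp
    omega

theorem left_unique (h : Spliced b w t) (h' : Spliced b' w t) : b = b' := by
  induction h generalizing b' with
  | nil =>
    cases h' with
    | nil => rfl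
    | other h _ => omega
  | excursion h ih =>
    cases h' with
    | excursion h' => rw [ih h']
    | other h _ => omega
  | root h ih =>
    cases h' with
    | root h' => rw [ih h']
    | other h _ => omega
  | other hx h ih =>
    cases h' with
    | other _ h' => rw [ih h']
    | _ => omega

theorem right_unique (h : Spliced b w t) (h' : Spliced b w' t') : w = w' ∧ t = t' := by
  induction h generalizing w' t' with
  | nil =>
    cases h' with
    | nil => exact ⟨rfl, rfl⟩
    | root h => exact (not_nil_left h).elim
    | other h _ => omega
  | excursion h ih =>
    cases h' with
    | excursion h' =>
      obtain ⟨h₁, rfl⟩ := ih h'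
      exact ⟨h₁, rfl⟩
    | root h => exact (not_one_cons h).elim
    | other h _ => omega
  | root h ih =>
    cases h' with
    | nil => exact (not_nil_left h).elim
    | excursion _ => exact (not_one_cons h).elim
    | root h' =>
      obtain ⟨rfl, rfl⟩ := ih h'
      exact ⟨rfl, rfl⟩
    | other h _ => omega
  | other hx h ih =>
    cases h' with
    | other _ h' =>
      obtain ⟨rfl, rfl⟩ := ih h'
      exact ⟨rfl, rfl⟩
    | _ => omega

theorem exists_left (hpos : ∀ x ∈ w, 1 ≤ x) (hlast : w.getLast? = some 1)
    (ht : w.count 1 = t.count false + 1) : ∃ b, Spliced b w t := by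
  induction w generalizing t with
  | nil => simp at hlast
  | cons x w ih =>
    have hpos' : ∀ y ∈ w, 1 ≤ y := fun y hy => hpos y (List.mem_cons_of_mem _ hy)
    have hlast' (hw : w ≠ []) : w.getLast? = some 1 := by
      rw [← hlast, List.getLast?_cons, List.getLast?_eq_some_getLast hw]; rfl
    by_cases hx : x = 1
    · subst hx
      induction t with
      | nil =>
        have hw : w = [] := by
          by_contra hw
          have := List.mem_of_getLast? (hlast' hw)
          simp [List.count_eq_zero] at ht
          exact ht this
        subst hw
        exact ⟨_, .nil⟩
      | cons s t iht =>
        cases s with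
        | true =>
          obtain ⟨b, hb⟩ := iht (by simpa using ht)
          exact ⟨_, hb.excursion⟩
        | false =>
          have ht' : w.count 1 = t.count false + 1 := by simpa using ht
          have hw : w ≠ [] := by rintro rfl; simp at ht'
          obtain ⟨b, hb⟩ := ih hpos' (hlast' hw) ht'
          exact ⟨_, hb.root⟩
    · have hw : w ≠ [] := by rintro rfl; simp at hlast; exact hx hlast
      have h1 := hpos x (by simp)
      obtain ⟨b, hb⟩ := ih hpos' (hlast' hw) (t := t) (by simpa [List.count_cons, hx] using ht)
      exact ⟨_, hb.other (by omega)⟩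

theorem exists_right (hpos : ∀ x ∈ b, 1 ≤ x) (hlast : b.getLast? = some 2)
    (hhead : b.head? ≠ some 1) (hadj : ∀ e ∈ walkEdges b, 1 ∈ e → e = s(1, 2)) :
    ∃ w t, Spliced b w t := by
  induction hn : b.length using Nat.strong_induction_on generalizing b with | _ n ih
  subst hn
  rcases b with _ | ⟨x, _ | ⟨y, b⟩⟩
  · simp at hlast
  · obtain rfl : x = 2 := by simpa using hlast
    exact ⟨_, _, .nil⟩
  have hx1 : x ≠ 1 := by simpa using hhead
  have hx := hpos x (by simp)
  have hlast' : (y :: b).getLast? = some 2 := by simpa using hlast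
  have hpos' : ∀ z ∈ y :: b, 1 ≤ z := fun z hz => hpos z (List.mem_cons_of_mem _ hz)
  have hadj' : ∀ e ∈ walkEdges (y :: b), 1 ∈ e → e = s(1, 2) := fun e he =>
    hadj e (by simp [he])
  by_cases hy : y = 1
  · subst hy
    obtain rfl : x = 2 := by
      have := hadj s(x, 1) (by simp) (by simp)
      simpa [hx1] using this
    rcases b with _ | ⟨z, b⟩
    · simp at hlast'
    obtain rfl : z = 2 := by
      have := hadj' s(1, z) (by simp) (by simp)
      simpa using this
    obtain ⟨w, t, h⟩ := ih (2 :: b).length (by simp) (b := 2 :: b)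
      (fun z hz => hpos' z (List.mem_cons_of_mem _ hz)) (by simpa using hlast') (by simp)
      (fun e he => hadj' e (by simp only [walkEdges_cons_cons, Finset.mem_insert, he, or_true])) rfl
    obtain ⟨x, b₁, w₁, -, hb, rfl⟩ := h.exists_heads
    obtain rfl : x = 1 := by simp at hb; omega
    exact ⟨_, _, h.excursion⟩
  · obtain ⟨w, t, h⟩ := ih (y :: b).length (by simp) hpos' hlast' (by simpa using hy) hadj' rfl
    by_cases hx2 : x = 2
    · subst hx2
      exact ⟨_, _, h.root⟩
    · obtain ⟨z, rfl⟩ : ∃ z, x = z + 1 := ⟨x - 1, by omega⟩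
      exact ⟨_, _, h.other (by omega)⟩

end Spliced

theorem rootSteps_add_one {k : ℕ} {l : List ℕ} (h : l.length = k)
    (hlast : (1 :: l).getLast? = some 1) : rootSteps k (1 :: l) + 1 = (1 :: l).count 1 := by
  have h₁ : rootSteps k (1 :: l) = (1 :: l).dropLast.count 1 := by
    rw [← countP_walkSteps_fst]
    exact card_filter_range_eq_countP (by rw [← h]; rfl) fun p => p.1 = 1
  conv_rhs => rw [← List.dropLast_append_getLast? 1 hlast]
  rw [h₁, List.count_append, List.count_singleton_self]

theorem nuOutSteps_eq_countP {k : ℕ} {l : List ℕ} (h : (1 :: 2 :: l).length = k + 1) :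
    nuOutSteps k (1 :: 2 :: l) =
      (walkSteps (1 :: 2 :: l)).countP (fun p => p.1 = 2 ∧ p.2 ≠ 1) :=
  card_filter_range_eq_countP h fun p => p.1 = 2 ∧ p.2 ≠ 1

theorem walkEdges_append_two {b : List ℕ} (hb : b.getLast? = some 1) :
    walkEdges (b ++ [2]) = insert s(1, 2) (walkEdges b) := by
  obtain ⟨c, rfl⟩ : ∃ c, b = c ++ [1] := ⟨b.dropLast, (List.dropLast_append_getLast? 1 hb).symm⟩
  ext e
  simp [walkEdges, walkSteps_append_singleton, eq_comm]

theorem Spliced.mem_Lambda3_iff {b l : List ℕ} {t : List Bool} {f u v : ℕ}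
    (h : Spliced (b ++ [2]) (1 :: l) t) (hb : b.getLast? = some 1) :
    1 :: b ∈ Lambda3 (f + u) f v ↔ 1 :: l ∈ Lambda u v ∧ t ∈ Theta2Seq (f + v) f := by
  obtain ⟨b₁, rfl⟩ : ∃ b₁, b = 2 :: b₁ := by
    obtain ⟨x, b₂, w₁, -, h₁, h₂⟩ := h.exists_heads
    obtain rfl : 1 = x := by simpa using congrArg List.head? h₂
    cases b with
    | nil => simp at hb
    | cons y b => exact ⟨b, by simp at h₁; simp [h₁]⟩
  have hlast : (1 :: 2 :: b₁).getLast? = some 1 := by simpa [List.getLast?_cons] using hb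
  have hlast' := h.getLast?_right
  have htlast : t.getLast? = some true := by
    rw [h.getLast?_eq_some_true_iff]
    refine ⟨(2 :: b₁).dropLast, ?_⟩
    conv_rhs => rw [← List.dropLast_append_getLast? 1 hb]
    simp
  have htrue : true ∈ t := List.mem_of_getLast? htlast
  have hzero : 0 ∉ 1 :: l := fun h0 => absurd (h.pos 0 h0) (by omega)
  have hV : (1 :: 2 :: b₁).toFinset = insert 1 ((1 :: l).toFinset.image (· + 1)) := by
    have := h.toFinset_left
    rw [if_pos htrue] at this
    ext y
    have := congrArg (y ∈ ·) this
    simp at this ⊢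
    grind
  have hE : walkEdges (1 :: 2 :: b₁) =
      insert s(1, 2) ((walkEdges (1 :: l)).image (Sym2.map (· + 1))) := by
    have := h.walkEdges_left
    rw [if_pos htrue, walkEdges_append_two hb] at this
    rw [walkEdges_cons_cons, this, Finset.union_comm, Finset.insert_eq]
  have hVcard : (1 :: 2 :: b₁).toFinset.card = (1 :: l).toFinset.card + 1 := by
    rw [hV, Finset.card_insert_of_notMem, Finset.card_image_of_injective _ (add_left_injective 1)]
    simpa using hzero
  have hone : ∀ e ∈ (walkEdges (1 :: l)).image (Sym2.map (· + 1)), 1 ∉ e := by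
    intro e he h1
    obtain ⟨e, he', rfl⟩ := Finset.mem_image.1 he
    obtain ⟨x, hx, hx1⟩ := Sym2.mem_map.1 h1
    obtain rfl : x = 0 := by omega
    exact hzero (mem_of_mem_walkEdges he' hx)
  have hEcard : (walkEdges (1 :: 2 :: b₁)).card = (walkEdges (1 :: l)).card + 1 := by
    rw [hE, Finset.card_insert_of_notMem,
      Finset.card_image_of_injective _ (Sym2.map.injective (add_left_injective 1))]
    exact fun he => hone _ he (by simp)
  have hdiag : (∀ e ∈ walkEdges (1 :: 2 :: b₁), ¬ e.IsDiag) ↔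
      ∀ e ∈ walkEdges (1 :: l), ¬ e.IsDiag := by
    rw [hE]
    simp [Sym2.isDiag_map (add_left_injective 1)]
  have hmin : MinimalFrom {1} (2 :: b₁) ↔ MinimalFrom {1} l := by
    have h₁ := h.minimalFrom_iff (S := {1}) (by simp) (by simp)
    rw [minimalFrom_append_singleton (by simp)] at h₁
    simpa [MinimalFrom, Finset.pair_comm 2 1] using h₁
  have hdeg : ((walkEdges (1 :: 2 :: b₁)).filter fun e => 1 ∈ e).card = 1 := by
    rw [hE, Finset.filter_insert, if_pos (by simp), Finset.filter_false_of_mem hone]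
    rfl
  have hnu : (walkSteps (1 :: 2 :: b₁)).countP (fun p => p.1 = 2 ∧ p.2 ≠ 1) = t.count false := by
    rw [← h.countP_walkSteps, walkSteps_cons_cons]
    conv_rhs => rw [← List.dropLast_append_getLast? 1 hb]
    conv_lhs => rw [← List.dropLast_append_getLast? 1 hb]
    simp [walkSteps_append_singleton]
  have hlen := h.length_eq
  have hct := h.count_one_left
  have hcf := h.count_one_right
  have htlen := t.count_true_add_count_false
  simp only [List.cons_append, List.length_cons, List.length_append, List.length_nil] at hlen
  have hct : (2 :: b₁).count 1 = t.count true := by simpa using hct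
  have hess : IsEssential (2 * (t.count true + u)) (1 :: 2 :: b₁) ↔
      IsEssential (2 * u) (1 :: l) := by
    rw [isEssential_cons_iff, isEssential_cons_iff, hdiag, hmin, hEcard, hVcard]
    simp only [hlast, hlast', List.length_cons, add_left_inj]
    refine and_congr_left fun _ => ?_
    omega
  have hroot {k : ℕ} (hk : (2 :: b₁).length = k) : rootSteps k (1 :: 2 :: b₁) = t.count true := by
    have := rootSteps_add_one hk hlast
    rw [List.count_cons_self] at this
    omega
  have hroot' {k : ℕ} (hk : l.length = k) : rootSteps k (1 :: l) = t.count false := by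
    have := rootSteps_add_one hk hlast'
    omega
  constructor
  · rintro ⟨⟨⟨he, hr⟩, -⟩, hv⟩
    have hk := (isEssential_cons_iff.1 he).1
    rw [hroot hk] at hr
    subst hr
    rw [nuOutSteps_eq_countP (by rw [← hk]; rfl), hnu] at hv
    have he' := hess.1 he
    exact ⟨⟨he', (hroot' (isEssential_cons_iff.1 he').1).trans hv⟩, by omega, rfl, htlast⟩
  · rintro ⟨⟨he', hr⟩, -, rfl, -⟩
    have he := hess.2 he'
    have hk := (isEssential_cons_iff.1 he).1
    rw [hroot' (isEssential_cons_iff.1 he').1] at hr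
    refine ⟨⟨⟨he, hroot hk⟩, ?_⟩, ?_⟩
    · rw [edgeSet_eq_walkEdges (by rw [← hk]; rfl)]
      convert hdeg
      rfl
    · rw [nuOutSteps_eq_countP (by rw [← hk]; rfl), hnu, hr]

theorem exists_spliced_of_mem_Lambda3 {f u v : ℕ} (hf : 1 ≤ f) {w : List ℕ}
    (hw : w ∈ Lambda3 (f + u) f v) :
    ∃ w' ∈ Lambda u v, ∃ t ∈ Theta2Seq (f + v) f, Spliced (w.tail ++ [2]) w' t := by
  obtain ⟨⟨⟨he, -⟩, hdeg⟩, -⟩ := id hw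
  obtain ⟨b, rfl⟩ := he.exists_eq_cons
  obtain ⟨hk, hlast, hdiag, hmin, -⟩ := isEssential_cons_iff.1 he
  rcases b with _ | ⟨x, b⟩
  · simp at hk
    omega
  have hx1 : x ≠ 1 := by
    have := hdiag s(1, x) (by simp)
    simpa [eq_comm] using this
  obtain rfl : x = 2 := by
    have := hmin.1
    simp at this
    omega
  have hb : (2 :: b).getLast? = some 1 := by simpa [List.getLast?_cons] using hlast
  have hadj : ∀ e ∈ walkEdges (2 :: b ++ [2]), 1 ∈ e → e = s(1, 2) := by
    intro e he h1
    rw [walkEdges_append_two hb, ← walkEdges_cons_cons] at he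
    rw [edgeSet_eq_walkEdges (by rw [← hk]; rfl)] at hdeg
    refine Finset.card_le_one.1 hdeg.le _ (Finset.mem_filter.2 ⟨he, h1⟩) _
      (Finset.mem_filter.2 ⟨by simp, by simp⟩)
  have hpos : ∀ y ∈ 2 :: b ++ [2], 1 ≤ y := by
    have := hmin.pos (by simp)
    intro y hy
    rcases List.mem_append.1 hy with hy | hy
    · exact this y hy
    · simp at hy; omega
  obtain ⟨w', t, h⟩ := Spliced.exists_right hpos List.getLast?_concat (by simp) hadj
  obtain ⟨y, b₁, l, -, h₁, rfl⟩ := h.exists_heads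
  obtain rfl : y = 1 := by
    have := congrArg List.head? h₁
    simp at this
    omega
  obtain ⟨hw', ht⟩ := (h.mem_Lambda3_iff hb).1 hw
  exact ⟨_, hw', _, ht, h⟩

theorem exists_spliced_of_mem_Lambda {f u v : ℕ} {w : List ℕ} {t : List Bool}
    (hw : w ∈ Lambda u v) (ht : t ∈ Theta2Seq (f + v) f) :
    ∃ w' ∈ Lambda3 (f + u) f v, Spliced (w'.tail ++ [2]) w t := by
  obtain ⟨he, hr⟩ := id hw
  obtain ⟨l, rfl⟩ := he.exists_eq_cons
  obtain ⟨hk, hlast, hdiag, hmin, -⟩ := isEssential_cons_iff.1 he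
  obtain ⟨hlen, hct, htlast⟩ := id ht
  have hpos : ∀ y ∈ 1 :: l, 1 ≤ y := by
    have := hmin.pos (by simp)
    simpa using this
  have hcount : (1 :: l).count 1 = t.count false + 1 := by
    have := rootSteps_add_one hk hlast
    have := t.count_true_add_count_false
    omega
  obtain ⟨b, h⟩ := Spliced.exists_left hpos hlast hcount
  obtain ⟨b, rfl⟩ := h.getLast?_eq_some_true_iff.1 htlast
  have h : Spliced ((b ++ [1]) ++ [2]) (1 :: l) t := by simpa using h
  exact ⟨1 :: (b ++ [1]), (h.mem_Lambda3_iff (by simp)).2 ⟨hw, ht⟩, h⟩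

theorem nonempty_equiv_of_relation {A B : Type*} (r : A → B → Prop) (hl : ∀ a, ∃ b, r a b)
    (hr : ∀ b, ∃ a, r a b) (hul : ∀ a a' b, r a b → r a' b → a = a')
    (hur : ∀ a b b', r a b → r a b' → b = b') : Nonempty (A ≃ B) := by
  choose g hg using hl
  choose g' hg' using hr
  exact ⟨⟨g, g', fun a => hul _ _ _ (hg' _) (hg a), fun b => hur _ _ _ (hg _) (hg' b)⟩⟩

theorem exists_altWalk_eq_cons (f : ℕ) : ∃ l, altWalk f = 1 :: l ∧ l.length = 2 * f ∧
    (1 :: l).getLast? = some 1 := by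
  induction f with
  | zero => exact ⟨[], rfl, rfl, rfl⟩
  | succ f ih =>
    obtain ⟨l, h, hlen, hlast⟩ := ih
    exact ⟨2 :: altWalk f, rfl, by simp [h, hlen]; omega, by simp [h, hlast]⟩

theorem eq_of_mem_walkEdges_altWalk (f : ℕ) : ∀ e ∈ walkEdges (altWalk f), e = s(1, 2) := by
  induction f with
  | zero => simp [altWalk]
  | succ f ih =>
    obtain ⟨l, h, -⟩ := exists_altWalk_eq_cons f
    rw [altWalk, h]
    rw [h] at ih
    simpa [Sym2.eq_swap] using ih

theorem walkEdges_altWalk {f : ℕ} (hf : 1 ≤ f) : walkEdges (altWalk f) = {s(1, 2)} := by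
  refine Finset.eq_singleton_iff_unique_mem.2 ⟨?_, eq_of_mem_walkEdges_altWalk f⟩
  obtain ⟨f, rfl⟩ : ∃ g, f = g + 1 := ⟨f - 1, by omega⟩
  simp [altWalk]

theorem cons_eq_altWalk {f : ℕ} {l : List ℕ} (hl : l.length = 2 * f)
    (he : ∀ e ∈ walkEdges (1 :: l), e = s(1, 2)) : 1 :: l = altWalk f := by
  induction f generalizing l with
  | zero => simpa [altWalk] using hl
  | succ f ih =>
    rcases l with _ | ⟨x, _ | ⟨y, l⟩⟩
    · simp at hl
    · simp at hl; omega
    have hx := he s(1, x) (by simp)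
    obtain rfl : x = 2 := by simpa using hx
    have hy := he s(2, y) (by simp)
    obtain rfl : y = 1 := by simpa [Sym2.eq_swap] using hy
    have hl' : l.length = 2 * f := by simp at hl; omega
    rw [altWalk, ih hl' fun e h => he e (by simp [h])]

theorem minimalFrom_altWalk (f : ℕ) : MinimalFrom {1, 2} (altWalk f) := by
  induction f with
  | zero => simp [altWalk, MinimalFrom]
  | succ f ih => simpa [altWalk, MinimalFrom] using ih

theorem toFinset_altWalk {f : ℕ} (hf : 1 ≤ f) : (altWalk f).toFinset = {1, 2} := by
  induction f, hf using Nat.le_induction with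
  | base => simp [altWalk, Finset.pair_comm 2 1]
  | succ f hf ih => simp [altWalk, ih]

theorem isEssential_altWalk {f : ℕ} (hf : 1 ≤ f) : IsEssential (2 * f) (altWalk f) := by
  obtain ⟨l, h, hlen, hlast⟩ := exists_altWalk_eq_cons f
  have hE := walkEdges_altWalk hf
  have hV := toFinset_altWalk hf
  have hM := minimalFrom_altWalk (f - 1)
  rw [h] at hE hV ⊢
  refine isEssential_cons_iff.2 ⟨hlen, hlast, by simp [hE], ?_, by rw [hE, hV]; rfl⟩
  obtain ⟨g, rfl⟩ : ∃ g, f = g + 1 := ⟨f - 1, by omega⟩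
  obtain rfl : 2 :: altWalk g = l := (List.cons.inj h).2
  simpa [MinimalFrom, Finset.pair_comm 2 1] using hM

theorem Lambda4_eq_singleton {f : ℕ} (hf : 1 ≤ f) : Lambda4 f = {altWalk f} := by
  ext w
  rw [Set.mem_singleton_iff]
  constructor
  · rintro ⟨he, hE⟩
    obtain ⟨l, rfl⟩ := he.exists_eq_cons
    have hk := (isEssential_cons_iff.1 he).1
    rw [edgeSet_eq_walkEdges (by rw [← hk]; rfl)] at hE
    exact cons_eq_altWalk hk (by simp [hE])
  · rintro rfl
    have he := isEssential_altWalk hf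
    exact ⟨he, by rw [edgeSet_eq_walkEdges he.1.1, walkEdges_altWalk hf]⟩

theorem traversals_altWalk (f : ℕ) : traversals (2 * f) (altWalk f) s(1, 2) = 2 * f := by
  obtain ⟨l, h, hlen, -⟩ := exists_altWalk_eq_cons f
  have hk : (altWalk f).length = 2 * f + 1 := by rw [h, ← hlen]; rfl
  refine (card_filter_range_eq_countP hk fun p => s(p.1, p.2) = s(1, 2)).trans ?_
  rw [List.countP_eq_length.2]
  · simp [walkSteps, hk]
  · intro p hp
    simpa using eq_of_mem_walkEdges_altWalk f _ (mem_walkEdges.2 ⟨p, hp, rfl⟩)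

/-- **Bijection (3.18).** There is a bijection
`Λ_3(f+u,f,v) → Λ(u,v) × Λ_4(f) × Θ_2(f+v,f)`; moreover `Λ_4(f)` consists of exactly one
walk, the alternating walk `(1,2,1,2,…,2,1)` of length `2f`, whose weight contribution from
its single edge is `p X_{2f}`. -/
theorem second_edge_decomposition_bijection
    (p α : ℝ) (X : ℕ → ℝ) (f u v : ℕ) (hf : 1 ≤ f) (hvu : v ≤ u) :
    Nonempty ((Lambda3 (f + u) f v) ≃
      (Lambda u v) × (Lambda4 f) × (Theta2Seq (f + v) f)) ∧
    Lambda4 f = {altWalk f} ∧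
    (∏ e ∈ edgeSet (2 * f) (altWalk f),
        p * X (traversals (2 * f) (altWalk f) e)) = p * X (2 * f) := by
  have h4 := Lambda4_eq_singleton hf
  refine ⟨?_, h4, ?_⟩
  · refine nonempty_equiv_of_relation
      (fun a b => Spliced (a.1.tail ++ [2]) b.1.1 b.2.2.1) ?_ ?_ ?_ ?_
    · rintro ⟨w, hw⟩
      obtain ⟨w', hw', t, ht, h⟩ := exists_spliced_of_mem_Lambda3 hf hw
      exact ⟨⟨⟨w', hw'⟩, ⟨altWalk f, h4 ▸ rfl⟩, ⟨t, ht⟩⟩, h⟩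
    · rintro ⟨⟨w', hw'⟩, -, ⟨t, ht⟩⟩
      obtain ⟨w, hw, h⟩ := exists_spliced_of_mem_Lambda hw' ht
      exact ⟨⟨w, hw⟩, h⟩
    · rintro ⟨w, hw⟩ ⟨w', hw'⟩ b h h'
      obtain ⟨l, rfl⟩ := hw.1.1.1.exists_eq_cons
      obtain ⟨l', rfl⟩ := hw'.1.1.1.exists_eq_cons
      simpa using h.left_unique h'
    · rintro a ⟨⟨w, hw⟩, ⟨x, hx⟩, ⟨t, ht⟩⟩ ⟨⟨w', hw'⟩, ⟨x', hx'⟩, ⟨t', ht'⟩⟩ h h'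
      obtain ⟨rfl, rfl⟩ := h.right_unique h'
      rw [h4, Set.mem_singleton_iff] at hx hx'
      subst hx hx'
      rfl
  · rw [edgeSet_eq_walkEdges (isEssential_altWalk hf).1.1, walkEdges_altWalk hf,
      Finset.prod_singleton, traversals_altWalk]
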